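/- The integral ∫_0^∞ v·arctan(v/2) / cosh(πv) dv equals log 2 + 4 log Γ(3/4) + (1/2) log 3 - 2 log π + G/π, where G is Catalan's constant. -/

import Mathlib

open MeasureTheory

/-- Catalan's constant `G = ∑_{k≥0} (-1)^k/(2k+1)²`. -/
noncomputable def catalan' : ℝ := ∑' k : ℕ, (-1 : ℝ) ^ k / (2 * (k : ℝ) + 1) ^ 2

open Set Filter Topology

theorem norm_sech_term_le {b : ℝ} (hb : 0 < b) (v : ℝ) :
    |b / (b ^ 2 + v ^ 2) - (b + 1) / ((b + 1) ^ 2 + v ^ 2)| ≤ 1 / b ^ 2 := by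
  have h1 : 0 < b ^ 2 + v ^ 2 := by positivity
  have h2 : 0 < (b + 1) ^ 2 + v ^ 2 := by positivity
  have h3 : b / (b ^ 2 + v ^ 2) - (b + 1) / ((b + 1) ^ 2 + v ^ 2) =
      (b * (b + 1) - v ^ 2) / ((b + 1) ^ 2 + v ^ 2) * (1 / (b ^ 2 + v ^ 2)) := by
    field_simp
    ring
  rw [h3, abs_mul, abs_of_pos (show 0 < 1 / (b ^ 2 + v ^ 2) by positivity)]
  have h4 : |(b * (b + 1) - v ^ 2) / ((b + 1) ^ 2 + v ^ 2)| ≤ 1 := by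
    rw [abs_div, abs_of_pos h2, div_le_one h2, abs_le]
    constructor <;> nlinarith [sq_nonneg v, sq_nonneg b]
  calc _ ≤ 1 * (1 / (b ^ 2 + v ^ 2)) := by gcongr
    _ ≤ 1 / b ^ 2 := by
      rw [one_mul]
      gcongr
      nlinarith [sq_nonneg v]

theorem summable_one_div_shift_sq : Summable fun n : ℕ => 1 / (2 * (n : ℝ) + 1 / 2) ^ 2 := by
  have h := (Real.summable_one_div_nat_add_rpow (1 / 4) 2).mpr (by norm_num)
  refine (h.mul_left (1 / 4)).congr fun n => ?_
  rw [abs_of_pos (by positivity), Real.rpow_two]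
  field_simp
  ring

/-- Partial fraction expansion of the hyperbolic secant, with consecutive terms paired. -/
theorem hasSum_sech (v : ℝ) :
    HasSum (fun n : ℕ => (2 * (n : ℝ) + 1 / 2) / ((2 * (n : ℝ) + 1 / 2) ^ 2 + v ^ 2) -
      (2 * (n : ℝ) + 1 / 2 + 1) / ((2 * (n : ℝ) + 1 / 2 + 1) ^ 2 + v ^ 2))
      (Real.pi / (2 * Real.cosh (Real.pi * v))) := by
  set z : ℂ := ⟨1 / 4, v / 2⟩ with hz
  have hzmem : z ∈ Complex.integerComplement := by
    rw [Complex.mem_integerComplement_iff]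
    rintro ⟨n, hn⟩
    have h := congrArg Complex.re hn
    simp only [Complex.intCast_re, hz] at h
    have h4 : (4 * n : ℤ) = 1 := by
      have : (4 * n : ℝ) = 1 := by rw [h]; norm_num
      exact_mod_cast this
    omega
  have hcot : (Real.pi * Complex.cot (Real.pi * z)).re = Real.pi / Real.cosh (Real.pi * v) := by
    have hw : (Real.pi : ℂ) * z = ((Real.pi / 4 : ℝ) : ℂ) +
        ((Real.pi * v / 2 : ℝ) : ℂ) * Complex.I := by
      apply Complex.ext <;> simp [hz] <;> ring
    rw [hw, Complex.re_ofReal_mul, Complex.cot, Complex.cos_add_mul_I, Complex.sin_add_mul_I]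
    have hc : Real.cosh (Real.pi * v) =
        Real.cosh (Real.pi * v / 2) ^ 2 + Real.sinh (Real.pi * v / 2) ^ 2 := by
      rw [← Real.cosh_two_mul]; congr 1; ring
    have hs := Real.cosh_sq (Real.pi * v / 2)
    simp only [← Complex.ofReal_cos, ← Complex.ofReal_sin, ← Complex.ofReal_cosh,
      ← Complex.ofReal_sinh, Real.cos_pi_div_four, Real.sin_pi_div_four]
    rw [hc, div_eq_mul_one_div Real.pi]
    congr 1
    have hp : 0 < Real.cosh (Real.pi * v / 2) ^ 2 + Real.sinh (Real.pi * v / 2) ^ 2 := by positivity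
    generalize Real.cosh (Real.pi * v / 2) = C at *
    generalize Real.sinh (Real.pi * v / 2) = S at *
    rw [Complex.div_re]
    simp [Complex.normSq_apply]
    field_simp
    linear_combination hs
  have hre : ∀ N : ℕ, 2 * ∑ n ∈ Finset.range N,
      ((2 * (n : ℝ) + 1 / 2) / ((2 * (n : ℝ) + 1 / 2) ^ 2 + v ^ 2) -
      (2 * (n : ℝ) + 1 / 2 + 1) / ((2 * (n : ℝ) + 1 / 2 + 1) ^ 2 + v ^ 2)) =
      (1 / z + ∑ n ∈ Finset.range N, cotTerm z n).re -
        2 * ((2 * (N : ℝ) + 1 / 2) / ((2 * (N : ℝ) + 1 / 2) ^ 2 + v ^ 2)) := by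
    intro N
    induction N with
    | zero =>
      simp [Complex.normSq_apply, hz]
      field_simp
      ring
    | succ N ih =>
      rw [Finset.sum_range_succ, Finset.sum_range_succ, mul_add, ih]
      simp only [cotTerm, Complex.add_re, one_div, Complex.inv_re, Complex.normSq_apply]
      simp [hz]
      have h1 : (4⁻¹ - ((N : ℝ) + 1)) * (4⁻¹ - ((N : ℝ) + 1)) + v / 2 * (v / 2) =
        ((2 * (N : ℝ) + 2⁻¹ + 1) ^ 2 + v ^ 2) / 4 := by ring
      have h2 : (4⁻¹ + ((N : ℝ) + 1)) * (4⁻¹ + ((N : ℝ) + 1)) + v / 2 * (v / 2) =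
        ((2 * ((N : ℝ) + 1) + 2⁻¹) ^ 2 + v ^ 2) / 4 := by ring
      rw [h1, h2]
      have h3 : (2 * (N : ℝ) + 2⁻¹ + 1) ^ 2 + v ^ 2 ≠ 0 := by positivity
      have h4 : (2 * ((N : ℝ) + 1) + 2⁻¹) ^ 2 + v ^ 2 ≠ 0 := by positivity
      generalize (2 * (N : ℝ) + 2⁻¹ + 1) ^ 2 + v ^ 2 = A at *
      generalize (2 * ((N : ℝ) + 1) + 2⁻¹) ^ 2 + v ^ 2 = B at *
      field_simp
      ring
  have hsum : Summable (fun n : ℕ => (2 * (n : ℝ) + 1 / 2) / ((2 * (n : ℝ) + 1 / 2) ^ 2 + v ^ 2) -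
      (2 * (n : ℝ) + 1 / 2 + 1) / ((2 * (n : ℝ) + 1 / 2 + 1) ^ 2 + v ^ 2)) :=
    Summable.of_norm_bounded summable_one_div_shift_sq
      fun n => norm_sech_term_le (by positivity) v
  rw [hsum.hasSum_iff_tendsto_nat]
  have hlim := (Complex.continuous_re.tendsto _).comp
    ((tendsto_logDeriv_euler_cot_sub hzmem).const_add (1 / z))
  have hP : Tendsto (fun N : ℕ => 2 * ((2 * (N : ℝ) + 1 / 2) / ((2 * (N : ℝ) + 1 / 2) ^ 2 + v ^ 2)))
      atTop (𝓝 0) := by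
    have hb : Tendsto (fun N : ℕ => 2 / (2 * (N : ℝ) + 1 / 2)) atTop (𝓝 0) := by
      refine Tendsto.const_div_atTop ?_ _
      exact tendsto_atTop_add_const_right _ _
        (tendsto_natCast_atTop_atTop.const_mul_atTop (by norm_num))
    refine squeeze_zero (fun N => by positivity) (fun N => ?_) hb
    rw [← mul_div_assoc, div_le_div_iff₀ (by positivity) (by positivity)]
    nlinarith [sq_nonneg v]
  have h := (hlim.sub hP).const_mul (1 / 2)
  rw [add_sub_cancel, hcot] at h
  convert h using 2
  · rename_i N
    have := hre N
    simp only [Function.comp_apply]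
    rw [← this]; ring
  · ring

theorem tendsto_arctan_div_atTop {x : ℝ} (hx : 0 < x) :
    Tendsto (fun v : ℝ => Real.arctan (v / x)) atTop (𝓝 (Real.pi / 2)) :=
  (tendsto_nhds_of_tendsto_nhdsWithin Real.tendsto_arctan_atTop).comp
    (tendsto_id.atTop_div_const hx)

theorem hasDerivAt_arctan_div {x : ℝ} (hx : 0 < x) (v : ℝ) :
    HasDerivAt (fun v : ℝ => Real.arctan (v / x)) (x / (x ^ 2 + v ^ 2)) v := by
  refine ((hasDerivAt_id' v).div_const x).arctan.congr_deriv ?_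
  field_simp

theorem integrableOn_Ioi_inv_sq_add_sq {x : ℝ} (hx : 0 < x) :
    IntegrableOn (fun v : ℝ => 1 / (x ^ 2 + v ^ 2)) (Ioi 0) := by
  refine integrableOn_Ioi_deriv_of_nonneg' (g := fun v => Real.arctan (v / x) / x)
    (fun v _ => ?_) (fun v _ => by positivity) ((tendsto_arctan_div_atTop hx).div_const x)
  refine ((hasDerivAt_arctan_div hx v).div_const x).congr_deriv ?_
  field_simp

theorem integrableOn_Ioi_inv_mul_inv {x b : ℝ} (hx : 0 < x) (hb : 0 < b) :
    IntegrableOn (fun v : ℝ => 1 / (x ^ 2 + v ^ 2) * (b / (b ^ 2 + v ^ 2))) (Ioi 0) := by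
  refine ((integrableOn_Ioi_inv_sq_add_sq hx).mul_const (1 / b)).mono'
    (by fun_prop) (ae_of_all _ fun v => ?_)
  rw [Real.norm_of_nonneg (by positivity)]
  gcongr ?_ * ?_
  rw [div_le_div_iff₀ (by positivity) hb]
  nlinarith [sq_nonneg v]

theorem integral_Ioi_inv_mul_inv {x b : ℝ} (hx : 0 < x) (hb : 0 < b) :
    ∫ v in Ioi (0 : ℝ), 1 / (x ^ 2 + v ^ 2) * (b / (b ^ 2 + v ^ 2)) =
      Real.pi / (2 * x * (x + b)) := by
  rcases eq_or_ne x b with rfl | hne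
  · have hlim : Tendsto (fun v : ℝ => v / (x ^ 2 + v ^ 2)) atTop (𝓝 0) := by
      refine squeeze_zero' (g := fun v => v⁻¹) ?_ ?_ tendsto_inv_atTop_zero
      · filter_upwards [eventually_gt_atTop 0] with v hv
        positivity
      · filter_upwards [eventually_gt_atTop 0] with v hv
        rw [inv_eq_one_div, div_le_div_iff₀ (by positivity) hv]
        nlinarith
    rw [integral_Ioi_of_hasDerivAt_of_tendsto'
      (f := fun v => v / (x ^ 2 + v ^ 2) / (2 * x) + Real.arctan (v / x) / (2 * x ^ 2))
      (fun v _ => ?_) (integrableOn_Ioi_inv_mul_inv hx hb)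
      ((hlim.div_const _).add ((tendsto_arctan_div_atTop hx).div_const _))]
    · simp
      field_simp
      ring
    · have h0 : x ^ 2 + v ^ 2 ≠ 0 := by positivity
      refine ((((hasDerivAt_id' v).div (((hasDerivAt_id' v).fun_pow 2).const_add (x ^ 2))
        h0).div_const (2 * x)).add
        ((hasDerivAt_arctan_div hx v).div_const (2 * x ^ 2))).congr_deriv ?_
      simp only [Nat.cast_ofNat]
      field_simp
      ring
  · have hd : b ^ 2 - x ^ 2 ≠ 0 := by
      rw [sq_sub_sq]
      exact mul_ne_zero (by positivity) (sub_ne_zero.mpr hne.symm)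
    rw [integral_Ioi_of_hasDerivAt_of_tendsto'
      (f := fun v => (b / x * Real.arctan (v / x) - Real.arctan (v / b)) / (b ^ 2 - x ^ 2))
      (fun v _ => ?_) (integrableOn_Ioi_inv_mul_inv hx hb)
      ((((tendsto_arctan_div_atTop hx).const_mul _).sub (tendsto_arctan_div_atTop hb)).div_const _)]
    · simp
      field_simp
      ring
    · have h0 : x ^ 2 + v ^ 2 ≠ 0 := by positivity
      have h1 : b ^ 2 + v ^ 2 ≠ 0 := by positivity
      refine ((((hasDerivAt_arctan_div hx v).const_mul (b / x)).sub
        (hasDerivAt_arctan_div hb v)).div_const (b ^ 2 - x ^ 2)).congr_deriv ?_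
      field_simp
      ring

/-- Termwise integration of the partial fraction expansion of the hyperbolic secant against
`x² / (x² + v²)`. -/
theorem hasSum_integral_sq_div_sech {x : ℝ} (hx : 0 ≤ x) :
    HasSum (fun n : ℕ => x / (x + (2 * (n : ℝ) + 1 / 2)) - x / (x + (2 * (n : ℝ) + 1 / 2 + 1)))
      (∫ v in Ioi (0 : ℝ), x ^ 2 / (x ^ 2 + v ^ 2) * (1 / Real.cosh (Real.pi * v))) := by
  rcases hx.eq_or_lt with rfl | hx
  · simp
  have hpi := Real.pi_pos
  set F : ℕ → ℝ → ℝ := fun n v => 1 / (x ^ 2 + v ^ 2) *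
    ((2 * (n : ℝ) + 1 / 2) / ((2 * (n : ℝ) + 1 / 2) ^ 2 + v ^ 2)) - 1 / (x ^ 2 + v ^ 2) *
      ((2 * (n : ℝ) + 1 / 2 + 1) / ((2 * (n : ℝ) + 1 / 2 + 1) ^ 2 + v ^ 2)) with hF
  have hint : ∀ n, IntegrableOn (F n) (Ioi 0) := fun n =>
    (integrableOn_Ioi_inv_mul_inv hx (by positivity)).sub
      (integrableOn_Ioi_inv_mul_inv hx (by positivity))
  have hI0 := integrableOn_Ioi_inv_sq_add_sq hx
  have hnorm : Summable fun n => ∫ v in Ioi (0 : ℝ), ‖F n v‖ := by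
    refine Summable.of_nonneg_of_le (fun n => integral_nonneg fun v => norm_nonneg _) (fun n => ?_)
      (summable_one_div_shift_sq.mul_left (∫ v in Ioi (0 : ℝ), 1 / (x ^ 2 + v ^ 2)))
    rw [← integral_mul_const]
    refine integral_mono (hint n).norm (hI0.mul_const _) fun v => ?_
    simp only [hF]
    rw [← mul_sub, norm_mul, Real.norm_of_nonneg (show 0 ≤ 1 / (x ^ 2 + v ^ 2) by positivity)]
    gcongr
    exact norm_sech_term_le (by positivity) v
  have h := (hasSum_integral_of_summable_integral_norm hint hnorm).mul_left (2 * x ^ 2 / Real.pi)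
  rw [← integral_const_mul] at h
  have hterm : ∀ n : ℕ, 2 * x ^ 2 / Real.pi * ∫ v in Ioi (0 : ℝ), F n v =
      x / (x + (2 * (n : ℝ) + 1 / 2)) - x / (x + (2 * (n : ℝ) + 1 / 2 + 1)) := fun n => by
    simp only [hF]
    rw [integral_sub (integrableOn_Ioi_inv_mul_inv hx (by positivity))
      (integrableOn_Ioi_inv_mul_inv hx (by positivity)),
      integral_Ioi_inv_mul_inv hx (by positivity), integral_Ioi_inv_mul_inv hx (by positivity)]
    field_simp
  have hfun : ∀ v : ℝ, 2 * x ^ 2 / Real.pi * ∑' n, F n v =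
      x ^ 2 / (x ^ 2 + v ^ 2) * (1 / Real.cosh (Real.pi * v)) := fun v => by
    simp only [hF, ← mul_sub]
    rw [((hasSum_sech v).mul_left _).tsum_eq]
    have := Real.cosh_pos (Real.pi * v)
    field_simp
  simpa only [hterm, hfun] using h

theorem hasDerivAt_arctan_sinh_pi_mul (v : ℝ) :
    HasDerivAt (fun v : ℝ => Real.arctan (Real.sinh (Real.pi * v)) / Real.pi)
      (1 / Real.cosh (Real.pi * v)) v := by
  refine (((hasDerivAt_id' v).const_mul Real.pi).sinh.arctan.div_const Real.pi).congr_deriv ?_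
  have h := Real.cosh_pos (Real.pi * v)
  rw [add_comm, ← Real.cosh_sq]
  have := Real.pi_pos
  field_simp

theorem tendsto_arctan_sinh_pi_mul :
    Tendsto (fun v : ℝ => Real.arctan (Real.sinh (Real.pi * v)) / Real.pi) atTop (𝓝 (1 / 2)) := by
  have h : Tendsto (fun v : ℝ => Real.sinh (Real.pi * v)) atTop atTop := by
    refine tendsto_atTop_mono' _ ?_ (tendsto_id.const_mul_atTop Real.pi_pos)
    filter_upwards [eventually_ge_atTop 0] with v hv
    exact Real.self_le_sinh_iff.mpr (mul_nonneg Real.pi_pos.le hv)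
  have h2 := ((tendsto_nhds_of_tendsto_nhdsWithin Real.tendsto_arctan_atTop).comp h).div_const
    Real.pi
  rwa [div_right_comm, div_self Real.pi_ne_zero] at h2

theorem integrableOn_sech_pi_mul :
    IntegrableOn (fun v : ℝ => 1 / Real.cosh (Real.pi * v)) (Ioi 0) :=
  integrableOn_Ioi_deriv_of_nonneg' (fun v _ => hasDerivAt_arctan_sinh_pi_mul v)
    (fun _ _ => (one_div_pos.mpr (Real.cosh_pos _)).le) tendsto_arctan_sinh_pi_mul

theorem integral_sech_pi_mul : ∫ v in Ioi (0 : ℝ), 1 / Real.cosh (Real.pi * v) = 1 / 2 := by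
  rw [integral_Ioi_of_hasDerivAt_of_tendsto' (fun v _ => hasDerivAt_arctan_sinh_pi_mul v)
    integrableOn_sech_pi_mul tendsto_arctan_sinh_pi_mul]
  simp

theorem integral_Ioi_mul_exp_neg_mul {c : ℝ} (hc : 0 < c) :
    ∫ v in Ioi (0 : ℝ), v * Real.exp (-(c * v)) = 1 / c ^ 2 := by
  have h := Real.integral_rpow_mul_exp_neg_mul_Ioi (a := 2) (r := c) (by norm_num) hc
  norm_num [Real.Gamma_two] at h
  simpa using h

theorem integrableOn_Ioi_mul_exp_neg_mul {c : ℝ} (hc : 0 < c) :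
    IntegrableOn (fun v : ℝ => v * Real.exp (-(c * v))) (Ioi 0) := by
  refine Integrable.of_integral_ne_zero ?_
  rw [integral_Ioi_mul_exp_neg_mul hc]
  positivity

theorem hasSum_mul_sech_pi_mul {v : ℝ} (hv : 0 < v) :
    HasSum (fun k : ℕ => 2 * (-1 : ℝ) ^ k * (v * Real.exp (-((2 * (k : ℝ) + 1) * Real.pi * v))))
      (v / Real.cosh (Real.pi * v)) := by
  have hpi := Real.pi_pos
  have hr : |-Real.exp (-(2 * (Real.pi * v)))| < 1 := by
    rw [abs_neg, Real.abs_exp, Real.exp_lt_one_iff]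
    have := mul_pos hpi hv
    linarith
  have h := (hasSum_geometric_of_abs_lt_one hr).mul_left (2 * v * Real.exp (-(Real.pi * v)))
  have hterm : ∀ k : ℕ, 2 * (-1 : ℝ) ^ k * (v * Real.exp (-((2 * (k : ℝ) + 1) * Real.pi * v))) =
      2 * v * Real.exp (-(Real.pi * v)) * (-Real.exp (-(2 * (Real.pi * v)))) ^ k := fun k => by
    rw [neg_pow (Real.exp _), ← Real.exp_nat_mul,
      show -((2 * (k : ℝ) + 1) * Real.pi * v) = -(Real.pi * v) + k * -(2 * (Real.pi * v)) by ring,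
      Real.exp_add]
    ring
  have hval : v / Real.cosh (Real.pi * v) =
      2 * v * Real.exp (-(Real.pi * v)) * (1 - -Real.exp (-(2 * (Real.pi * v))))⁻¹ := by
    rw [Real.cosh_eq, sub_neg_eq_add,
      show -(2 * (Real.pi * v)) = -(Real.pi * v) + -(Real.pi * v) by ring, Real.exp_add,
      Real.exp_neg]
    have := Real.exp_pos (Real.pi * v)
    field_simp
  rw [hval]
  simpa only [hterm] using h

theorem integrableOn_mul_sech_pi_mul :
    IntegrableOn (fun v : ℝ => v / Real.cosh (Real.pi * v)) (Ioi 0) := by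
  refine ((integrableOn_Ioi_mul_exp_neg_mul Real.pi_pos).const_mul 2).mono'
    (Measurable.aestronglyMeasurable (by fun_prop)) ?_
  filter_upwards [ae_restrict_mem measurableSet_Ioi] with v hv
  have hv : 0 < v := hv
  have hc := Real.cosh_pos (Real.pi * v)
  rw [Real.norm_of_nonneg (by positivity), div_le_iff₀ hc, Real.cosh_eq, Real.exp_neg]
  have := Real.exp_pos (Real.pi * v)
  field_simp
  nlinarith

theorem integral_mul_sech_pi_mul :
    ∫ v in Ioi (0 : ℝ), v / Real.cosh (Real.pi * v) = 2 * catalan' / Real.pi ^ 2 := by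
  have hpi := Real.pi_pos
  have hc : ∀ k : ℕ, 0 < (2 * (k : ℝ) + 1) * Real.pi := fun k => by positivity
  have hsum : Summable fun k : ℕ => 1 / ((2 * (k : ℝ) + 1) * Real.pi) ^ 2 := by
    refine Summable.of_nonneg_of_le (fun k => by positivity) (fun k => ?_)
      summable_one_div_shift_sq
    gcongr
    have : (2 * (k : ℝ) + 1) * 1 ≤ (2 * (k : ℝ) + 1) * Real.pi := by
      gcongr
      linarith [Real.pi_gt_three]
    linarith
  have h := hasSum_integral_of_summable_integral_norm (μ := volume.restrict (Ioi (0 : ℝ)))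
    (F := fun (k : ℕ) (v : ℝ) =>
      2 * (-1 : ℝ) ^ k * (v * Real.exp (-((2 * (k : ℝ) + 1) * Real.pi * v))))
    (fun k => (integrableOn_Ioi_mul_exp_neg_mul (hc k)).const_mul _) (by
      refine (hsum.mul_left 2).congr fun k => ?_
      rw [← integral_Ioi_mul_exp_neg_mul (hc k), ← integral_const_mul]
      refine setIntegral_congr_fun measurableSet_Ioi fun v hv => ?_
      have hv : 0 < v := hv
      simp [abs_of_pos hv])
  rw [setIntegral_congr_fun measurableSet_Ioi fun v hv => (hasSum_mul_sech_pi_mul hv).tsum_eq] at h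
  rw [← h.tsum_eq, catalan', mul_comm, mul_div_assoc, ← tsum_mul_right]
  refine tsum_congr fun k => ?_
  rw [integral_const_mul, integral_Ioi_mul_exp_neg_mul (hc k)]
  field_simp

theorem intervalIntegral_sq_div_sq_add_sq {v : ℝ} (hv : 0 < v) :
    ∫ x in (0 : ℝ)..2, x ^ 2 / (x ^ 2 + v ^ 2) = 2 - v * Real.arctan (2 / v) := by
  have hne : ∀ x : ℝ, x ^ 2 + v ^ 2 ≠ 0 := fun x => by positivity
  have hderiv : ∀ x : ℝ, HasDerivAt (fun x : ℝ => x - v * Real.arctan (x / v))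
      (x ^ 2 / (x ^ 2 + v ^ 2)) x := fun x => by
    refine ((hasDerivAt_id' x).sub ((hasDerivAt_arctan_div hv x).const_mul v)).congr_deriv ?_
    have := hne x
    rw [add_comm (v ^ 2)]
    field_simp
    ring
  have hcont : Continuous fun x : ℝ => x ^ 2 / (x ^ 2 + v ^ 2) :=
    Continuous.div (by fun_prop) (by fun_prop) hne
  rw [intervalIntegral.integral_eq_sub_of_hasDerivAt (fun x _ => hderiv x)
    (hcont.intervalIntegrable _ _)]
  simp

theorem intervalIntegral_integral_sq_div_sech :
    ∫ x in (0 : ℝ)..2, ∫ v in Ioi (0 : ℝ),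
        x ^ 2 / (x ^ 2 + v ^ 2) * (1 / Real.cosh (Real.pi * v)) =
      ∫ v in Ioi (0 : ℝ), (2 - v * Real.arctan (2 / v)) * (1 / Real.cosh (Real.pi * v)) := by
  rw [intervalIntegral_integral_swap]
  · refine setIntegral_congr_fun measurableSet_Ioi fun v hv => ?_
    rw [intervalIntegral.integral_mul_const, intervalIntegral_sq_div_sq_add_sq hv]
  · have hb : Integrable (fun p : ℝ × ℝ => (1 : ℝ) * (1 / Real.cosh (Real.pi * p.2)))
        ((volume.restrict (Set.uIoc 0 2)).prod (volume.restrict (Ioi (0 : ℝ)))) :=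
      Integrable.mul_prod (f := fun _ => (1 : ℝ)) 
        (integrableOn_const (by simp)) integrableOn_sech_pi_mul
    refine hb.mono' (Measurable.aestronglyMeasurable ?_) (ae_of_all _ fun p => ?_)
    · unfold Function.uncurry
      fun_prop
    · have := Real.cosh_pos (Real.pi * p.2)
      simp only [Function.uncurry]
      rw [Real.norm_of_nonneg (by positivity)]
      gcongr
      exact div_le_one_of_le₀ (by nlinarith [sq_nonneg p.2]) (by positivity)

theorem intervalIntegrable_div_add {b : ℝ} (hb : 0 < b) :
    IntervalIntegrable (fun x : ℝ => x / (x + b)) volume 0 2 := by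
  refine (ContinuousOn.div (by fun_prop) (by fun_prop) fun x hx => ?_).intervalIntegrable
  rw [Set.uIcc_of_le (by norm_num)] at hx
  linarith [hx.1]

theorem intervalIntegral_div_add {b : ℝ} (hb : 0 < b) :
    ∫ x in (0 : ℝ)..2, x / (x + b) = 2 - b * (Real.log (b + 2) - Real.log b) := by
  have hderiv : ∀ x ∈ Set.uIcc (0 : ℝ) 2,
      HasDerivAt (fun x : ℝ => x - b * Real.log (x + b)) (x / (x + b)) x := fun x hx => by
    rw [Set.uIcc_of_le (by norm_num)] at hx
    have hpos : 0 < x + b := by linarith [hx.1]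
    refine ((hasDerivAt_id' x).sub
      ((((hasDerivAt_id' x).add_const b).log hpos.ne').const_mul b)).congr_deriv ?_
    field_simp
    ring
  rw [intervalIntegral.integral_eq_sub_of_hasDerivAt hderiv (intervalIntegrable_div_add hb),
    zero_add, add_comm b 2]
  ring

theorem hasSum_integral_sub_mul_arctan_mul_sech :
    HasSum (fun n : ℕ =>
      (2 * (n : ℝ) + 1 / 2 + 1) *
        (Real.log (2 * (n : ℝ) + 1 / 2 + 1 + 2) - Real.log (2 * (n : ℝ) + 1 / 2 + 1)) -
      (2 * (n : ℝ) + 1 / 2) *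
        (Real.log (2 * (n : ℝ) + 1 / 2 + 2) - Real.log (2 * (n : ℝ) + 1 / 2)))
      (∫ v in Ioi (0 : ℝ), (2 - v * Real.arctan (2 / v)) * (1 / Real.cosh (Real.pi * v))) := by
  rw [← intervalIntegral_integral_sq_div_sech]
  have h := intervalIntegral.hasSum_integral_of_dominated_convergence (μ := volume) (a := 0) (b := 2)
    (F := fun (n : ℕ) (x : ℝ) =>
      x / (x + (2 * (n : ℝ) + 1 / 2)) - x / (x + (2 * (n : ℝ) + 1 / 2 + 1)))
    (fun n _ => 2 * (1 / (2 * (n : ℝ) + 1 / 2) ^ 2))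
    (fun n => Measurable.aestronglyMeasurable (by fun_prop))
    (fun n => ae_of_all _ fun x hx => ?_)
    (ae_of_all _ fun x _ => summable_one_div_shift_sq.mul_left 2)
    intervalIntegrable_const
    (ae_of_all _ fun x hx => hasSum_integral_sq_div_sech ?_)
  · refine h.congr_fun fun n => ?_
    rw [intervalIntegral.integral_sub (intervalIntegrable_div_add (by positivity))
      (intervalIntegrable_div_add (by positivity)), intervalIntegral_div_add (by positivity),
      intervalIntegral_div_add (by positivity)]
    ring
  · rw [Set.uIoc_of_le (by norm_num)] at hx
    obtain ⟨h0, h2⟩ := hx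
    have hb : (0 : ℝ) < 2 * (n : ℝ) + 1 / 2 := by positivity
    generalize 2 * (n : ℝ) + 1 / 2 = b at *
    have : x / (x + b) - x / (x + (b + 1)) = x * (1 / ((x + b) * (x + (b + 1)))) := by
      field_simp
      ring
    rw [this, Real.norm_of_nonneg (by positivity)]
    gcongr
    nlinarith
  · rw [Set.uIoc_of_le (by norm_num)] at hx
    exact hx.1.le

theorem tendsto_mul_log_sub_log :
    Tendsto (fun n : ℕ => (2 * (n : ℝ)) *
      (Real.log (2 * (n : ℝ) + 1 / 2 + 1) - Real.log (2 * (n : ℝ) + 1 / 2))) atTop (𝓝 1) := by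
  have hb : Tendsto (fun n : ℕ => 2 * (n : ℝ) + 1 / 2) atTop atTop :=
    tendsto_atTop_add_const_right _ _ (tendsto_natCast_atTop_atTop.const_mul_atTop (by norm_num))
  have h1 := (Real.tendsto_mul_log_one_add_div_atTop 1).comp hb
  have h2 : Tendsto (fun n : ℕ => 1 - 1 / 2 / (2 * (n : ℝ) + 1 / 2)) atTop (𝓝 (1 - 0)) :=
    tendsto_const_nhds.sub (hb.const_div_atTop _)
  have h := h2.mul h1
  rw [sub_zero, mul_one] at h
  refine h.congr fun n => ?_
  have hp : (0 : ℝ) < 2 * (n : ℝ) + 1 / 2 := by positivity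
  simp only [Function.comp_apply]
  rw [← Real.log_div (by positivity) (by positivity), add_div, div_self hp.ne']
  field_simp
  ring

/-- The partial sums telescope up to a combination of Gauss's approximations of `log Γ`. -/
theorem sum_range_eq_logGammaSeq (n : ℕ) :
    ∑ m ∈ Finset.range (n + 1), ((2 * (m : ℝ) + 1 / 2 + 1) *
        (Real.log (2 * (m : ℝ) + 1 / 2 + 1 + 2) - Real.log (2 * (m : ℝ) + 1 / 2 + 1)) -
      (2 * (m : ℝ) + 1 / 2) *
        (Real.log (2 * (m : ℝ) + 1 / 2 + 2) - Real.log (2 * (m : ℝ) + 1 / 2))) =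
      (2 * ((n + 1 : ℕ) : ℝ)) * (Real.log (2 * ((n + 1 : ℕ) : ℝ) + 1 / 2 + 1) -
        Real.log (2 * ((n + 1 : ℕ) : ℝ) + 1 / 2)) -
      (1 / 2) * (Real.BohrMollerup.logGammaSeq (1 / 4) n +
        3 * Real.BohrMollerup.logGammaSeq (5 / 4) n -
        3 * Real.BohrMollerup.logGammaSeq (3 / 4) n - Real.BohrMollerup.logGammaSeq (7 / 4) n) := by
  have hlog : ∀ x : ℝ, 0 < x → ∀ m : ℕ, Real.log (x + m) =
      Real.log (2 * x + 2 * m) - Real.log 2 := fun x hx m => by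
    rw [← mul_add, Real.log_mul (by norm_num) (by positivity)]
    ring
  have key : ∀ N : ℕ, ∑ m ∈ Finset.range N, ((2 * (m : ℝ) + 1 / 2 + 1) *
        (Real.log (2 * (m : ℝ) + 1 / 2 + 1 + 2) - Real.log (2 * (m : ℝ) + 1 / 2 + 1)) -
      (2 * (m : ℝ) + 1 / 2) *
        (Real.log (2 * (m : ℝ) + 1 / 2 + 2) - Real.log (2 * (m : ℝ) + 1 / 2))) =
      (2 * (N : ℝ)) * (Real.log (2 * (N : ℝ) + 1 / 2 + 1) - Real.log (2 * (N : ℝ) + 1 / 2)) +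
      (1 / 2) * (∑ m ∈ Finset.range N, Real.log (1 / 4 + m) +
        3 * ∑ m ∈ Finset.range N, Real.log (5 / 4 + m) -
        3 * ∑ m ∈ Finset.range N, Real.log (3 / 4 + m) -
        ∑ m ∈ Finset.range N, Real.log (7 / 4 + m)) := by
    intro N
    induction N with
    | zero => simp
    | succ N ih =>
      simp only [Finset.sum_range_succ] at ih ⊢
      rw [ih, hlog _ (by norm_num), hlog _ (by norm_num), hlog _ (by norm_num),
        hlog _ (by norm_num)]
      push_cast
      ring_nf
  rw [key]
  simp only [Real.BohrMollerup.logGammaSeq]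
  ring

theorem integral_sub_mul_arctan_mul_sech :
    ∫ v in Ioi (0 : ℝ), (2 - v * Real.arctan (2 / v)) * (1 / Real.cosh (Real.pi * v)) =
      1 + Real.log 2 + 4 * Real.log (Real.Gamma (3 / 4)) + (1 / 2) * Real.log 3 -
        2 * Real.log Real.pi := by
  have h := (tendsto_add_atTop_iff_nat 1).mpr hasSum_integral_sub_mul_arctan_mul_sech.tendsto_sum_nat
  simp only [sum_range_eq_logGammaSeq] at h
  have hG := fun {x : ℝ} (hx : 0 < x) => Real.BohrMollerup.tendsto_log_gamma hx
  have h2 := ((tendsto_add_atTop_iff_nat 1).mpr tendsto_mul_log_sub_log).sub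
    (((((hG (x := 1 / 4) (by norm_num)).add ((hG (x := 5 / 4) (by norm_num)).const_mul 3)).sub
    ((hG (x := 3 / 4) (by norm_num)).const_mul 3)).sub (hG (x := 7 / 4) (by norm_num))).const_mul
    (1 / 2))
  rw [tendsto_nhds_unique h h2]
  have hA := Real.Gamma_pos_of_pos (show (0 : ℝ) < 1 / 4 by norm_num)
  have hB := Real.Gamma_pos_of_pos (show (0 : ℝ) < 3 / 4 by norm_num)
  have e1 : Real.log (Real.Gamma (5 / 4)) = Real.log (Real.Gamma (1 / 4)) - 2 * Real.log 2 := by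
    rw [show (5 / 4 : ℝ) = 1 / 4 + 1 by norm_num, Real.Gamma_add_one (by norm_num),
      Real.log_mul (by norm_num) hA.ne', show (1 / 4 : ℝ) = (2 ^ 2)⁻¹ by norm_num, Real.log_inv,
      Real.log_pow]
    push_cast
    ring
  have e2 : Real.log (Real.Gamma (7 / 4)) =
      Real.log (Real.Gamma (3 / 4)) + Real.log 3 - 2 * Real.log 2 := by
    rw [show (7 / 4 : ℝ) = 3 / 4 + 1 by norm_num, Real.Gamma_add_one (by norm_num),
      Real.log_mul (by norm_num) hB.ne', Real.log_div (by norm_num) (by norm_num),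
      show (4 : ℝ) = 2 ^ 2 by norm_num, Real.log_pow]
    push_cast
    ring
  have e3 : Real.log (Real.Gamma (1 / 4)) + Real.log (Real.Gamma (3 / 4)) =
      Real.log Real.pi + Real.log 2 / 2 := by
    have hr := Real.Gamma_mul_Gamma_one_sub (1 / 4)
    rw [show (1 : ℝ) - 1 / 4 = 3 / 4 by norm_num, show Real.pi * (1 / 4) = Real.pi / 4 by ring,
      Real.sin_pi_div_four] at hr
    rw [← Real.log_mul hA.ne' hB.ne', hr, Real.log_div Real.pi_ne_zero (by positivity),
      Real.log_div (by positivity) (by norm_num), Real.log_sqrt (by norm_num)]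
    ring
  rw [e1, e2]
  linear_combination -2 * e3

/-- `∫_0^∞ v arctan(v/2) / cosh(πv) dv = log 2 + 4 log Γ(3/4) + (1/2) log 3 - 2 log π + G/π`. -/
theorem integral_v_arctan_half_v :
    ∫ v in Set.Ioi (0 : ℝ), v * Real.arctan (v / 2) / Real.cosh (Real.pi * v) =
      Real.log 2 + 4 * Real.log (Real.Gamma (3 / 4)) + (1 / 2) * Real.log 3 -
        2 * Real.log Real.pi + catalan' / Real.pi := by
  have hpi := Real.pi_pos
  have hint : IntegrableOn
      (fun v : ℝ => (2 - v * Real.arctan (2 / v)) * (1 / Real.cosh (Real.pi * v))) (Ioi 0) := by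
    refine ((integrableOn_sech_pi_mul.const_mul 2).add
      (integrableOn_mul_sech_pi_mul.const_mul (Real.pi / 2))).mono'
      (Measurable.aestronglyMeasurable (by fun_prop)) ?_
    filter_upwards [ae_restrict_mem measurableSet_Ioi] with v hv
    have hv : 0 < v := hv
    have hc := Real.cosh_pos (Real.pi * v)
    have h1 := Real.arctan_lt_pi_div_two (2 / v)
    have h2 : 0 ≤ Real.arctan (2 / v) := Real.arctan_nonneg.mpr (by positivity)
    have h3 : |2 - v * Real.arctan (2 / v)| ≤ 2 + v * (Real.pi / 2) := by
      rw [abs_le]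
      constructor <;> nlinarith
    simp only [Pi.add_apply]
    rw [norm_mul, Real.norm_of_nonneg (show 0 ≤ 1 / Real.cosh (Real.pi * v) by positivity)]
    calc _ ≤ (2 + v * (Real.pi / 2)) * (1 / Real.cosh (Real.pi * v)) := by gcongr; exact h3
      _ = _ := by ring
  have hsplit : ∀ v ∈ Ioi (0 : ℝ), v * Real.arctan (v / 2) / Real.cosh (Real.pi * v) =
      Real.pi / 2 * (v / Real.cosh (Real.pi * v)) - 2 * (1 / Real.cosh (Real.pi * v)) +
        (2 - v * Real.arctan (2 / v)) * (1 / Real.cosh (Real.pi * v)) := fun v hv => by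
    have hv : 0 < v := hv
    have := Real.arctan_inv_of_pos (show 0 < 2 / v by positivity)
    rw [inv_div] at this
    rw [this]
    ring
  have h1 := integrableOn_mul_sech_pi_mul.const_mul (Real.pi / 2)
  have h2 := integrableOn_sech_pi_mul.const_mul 2
  have h12 : IntegrableOn (fun v : ℝ => Real.pi / 2 * (v / Real.cosh (Real.pi * v)) -
      2 * (1 / Real.cosh (Real.pi * v))) (Ioi 0) := h1.sub h2
  rw [setIntegral_congr_fun measurableSet_Ioi hsplit, integral_add h12 hint, integral_sub h1 h2,
    integral_const_mul, integral_const_mul, integral_mul_sech_pi_mul, integral_sech_pi_mul,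
    integral_sub_mul_arctan_mul_sech]
  field_simp
  ring
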